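/- arXiv:2102.01179 — 3 statements merged into one kernel-verified Lean document; each statement's English description precedes it below -/
import Mathlib

section
/- Let R be a ring, M a right R-module, and N a submodule of M. Then N is a distributive submodule of M if and only if for every submodule H of M, the quotient modules N/(N ⊓ H) and H/(N ⊓ H) have no nonzero isomorphic subfactors; explicitly: there do not exist submodules P, Q, P', Q' of M with N ⊓ H ≤ P < Q ≤ N and N ⊓ H ≤ P' < Q' ≤ H such that Q/P and Q'/P' are isomorphic R-modules. -/
/-- A submodule `N ⊆ M` is distributive if the sublattice of `𝓛(M)` generated by `N` and any
two submodules is distributive. -/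
def IsDistribSubmodule {R M : Type*} [Ring R] [AddCommGroup M] [Module R M]
    (N : Submodule R M) : Prop :=
  ∀ Y₁ Y₂ : Submodule R M, N ⊔ (Y₁ ⊓ Y₂) = (N ⊔ Y₁) ⊓ (N ⊔ Y₂)

theorem aux_equiv {S M : Type*} [Ring S] [AddCommGroup M] [Module S M]
    (G : Submodule S (M × M)) (P Q P' Q' : Submodule S M)
    (h1 : ∀ z ∈ G, z.1 ∈ Q) (h2 : ∀ z ∈ G, z.2 ∈ Q')
    (s1 : ∀ q ∈ Q, ∃ y, (q, y) ∈ G) (s2 : ∀ y ∈ Q', ∃ q, (q, y) ∈ G)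
    (hk : ∀ z ∈ G, z.1 ∈ P ↔ z.2 ∈ P') :
    Nonempty ((Q ⧸ Submodule.comap Q.subtype P) ≃ₗ[S]
      (Q' ⧸ Submodule.comap Q'.subtype P')) := by
  let f0 : G →ₗ[S] Q :=
    ((LinearMap.fst S M M).comp G.subtype).codRestrict Q (fun z => h1 _ z.2)
  let g0 : G →ₗ[S] Q' :=
    ((LinearMap.snd S M M).comp G.subtype).codRestrict Q' (fun z => h2 _ z.2)
  let f := (Submodule.comap Q.subtype P).mkQ.comp f0
  let g := (Submodule.comap Q'.subtype P').mkQ.comp g0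
  have hf : Function.Surjective f := by
    refine (Submodule.mkQ_surjective _).comp ?_
    rintro ⟨q, hq⟩
    obtain ⟨y, hy⟩ := s1 q hq
    exact ⟨⟨_, hy⟩, rfl⟩
  have hg : Function.Surjective g := by
    refine (Submodule.mkQ_surjective _).comp ?_
    rintro ⟨q, hq⟩
    obtain ⟨y, hy⟩ := s2 q hq
    exact ⟨⟨_, hy⟩, rfl⟩
  have hker : LinearMap.ker f = LinearMap.ker g := by
    ext z
    simp only [f, g, LinearMap.mem_ker, LinearMap.comp_apply, Submodule.mkQ_apply,
      Submodule.Quotient.mk_eq_zero, Submodule.mem_comap]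
    exact hk _ z.2
  exact ⟨(f.quotKerEquivOfSurjective hf).symm ≪≫ₗ Submodule.quotEquivOfEq _ _ hker ≪≫ₗ
    g.quotKerEquivOfSurjective hg⟩

theorem aux_back {S M : Type*} [Ring S] [AddCommGroup M] [Module S M]
    (N Y Z : Submodule S M) :
    Nonempty ((↥(N ⊓ (Y ⊔ Z)) ⧸ Submodule.comap (N ⊓ (Y ⊔ Z)).subtype (N ⊓ Y ⊔ N ⊓ Z)) ≃ₗ[S]
      (↥(Y ⊓ (N ⊔ Z)) ⧸ Submodule.comap (Y ⊓ (N ⊔ Z)).subtype (N ⊓ Y ⊔ Y ⊓ Z))) := by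
  let G : Submodule S (M × M) :=
    N.comap (LinearMap.fst S M M) ⊓ Y.comap (LinearMap.snd S M M) ⊓
      Z.comap (LinearMap.fst S M M - LinearMap.snd S M M)
  have hG : ∀ a b, (a, b) ∈ G ↔ (a ∈ N ∧ b ∈ Y) ∧ a - b ∈ Z := fun a b => Iff.rfl
  apply aux_equiv G
  · rintro ⟨a, b⟩ h
    obtain ⟨⟨ha, hb⟩, hc⟩ := (hG a b).1 h
    exact ⟨ha, Submodule.mem_sup.2 ⟨b, hb, a - b, hc, by abel⟩⟩
  · rintro ⟨a, b⟩ h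
    obtain ⟨⟨ha, hb⟩, hc⟩ := (hG a b).1 h
    exact ⟨hb, Submodule.mem_sup.2 ⟨a, ha, -(a - b), Z.neg_mem hc, by simp⟩⟩
  · rintro q ⟨hq, hq'⟩
    obtain ⟨y, hy, z, hz, rfl⟩ := Submodule.mem_sup.1 hq'
    exact ⟨y, (hG _ _).2 ⟨⟨hq, hy⟩, by simpa using hz⟩⟩
  · rintro y ⟨hy, hy'⟩
    obtain ⟨n, hn, z, hz, rfl⟩ := Submodule.mem_sup.1 hy'
    exact ⟨n, (hG _ _).2 ⟨⟨hn, hy⟩, by simpa using hz⟩⟩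
  · rintro ⟨a, b⟩ h
    obtain ⟨⟨ha, hb⟩, hc⟩ := (hG a b).1 h
    constructor
    · intro h
      obtain ⟨u, ⟨hu, hu'⟩, v, ⟨hv, hv'⟩, e⟩ := Submodule.mem_sup.1 h
      have e : u + v = a := e
      refine Submodule.mem_sup.2 ⟨u, ⟨hu, hu'⟩, b - u, ⟨Y.sub_mem hb hu', ?_⟩, by simp⟩
      have : b - u = v - (a - b) := by rw [← e]; abel
      rw [this]; exact Z.sub_mem hv' hc
    · intro h
      obtain ⟨u, ⟨hu, hu'⟩, v, ⟨hv, hv'⟩, e⟩ := Submodule.mem_sup.1 h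
      have e : u + v = b := e
      refine Submodule.mem_sup.2 ⟨u, ⟨hu, hu'⟩, a - u, ⟨N.sub_mem ha hu, ?_⟩, by simp⟩
      have : a - u = v + (a - b) := by rw [← e]; abel
      rw [this]; exact Z.add_mem hv' hc

theorem aux_main {S M : Type*} [Ring S] [AddCommGroup M] [Module S M] (N : Submodule S M) :
    IsDistribSubmodule N ↔
      ∀ H : Submodule S M,
        ¬ ∃ P Q P' Q' : Submodule S M,
          N ⊓ H ≤ P ∧ P < Q ∧ Q ≤ N ∧
          N ⊓ H ≤ P' ∧ P' < Q' ∧ Q' ≤ H ∧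
          Nonempty ((Q ⧸ Submodule.comap Q.subtype P) ≃ₗ[S]
            (Q' ⧸ Submodule.comap Q'.subtype P')) := by
  constructor
  · rintro hd H ⟨P, Q, P', Q', hP, hPQ, hQ, hP', hPQ', hQ', ⟨φ⟩⟩
    let G : Submodule S M :=
      { carrier := {m | ∃ (a : Q) (b : Q'), φ (Submodule.Quotient.mk a) =
          Submodule.Quotient.mk b ∧ (a : M) + b = m}
        zero_mem' := ⟨0, 0, by simp, by simp⟩
        add_mem' := by
          rintro _ _ ⟨a, b, h, rfl⟩ ⟨c, d, h', rfl⟩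
          refine ⟨a + c, b + d, by simp [h, h'], ?_⟩
          simp only [Submodule.coe_add]; abel
        smul_mem' := by
          rintro s _ ⟨a, b, h, rfl⟩
          exact ⟨s • a, s • b, by simp [h], by simp⟩ }
    obtain ⟨h, hh, hh'⟩ := SetLike.exists_of_lt hPQ'
    obtain ⟨q, hq⟩ := Submodule.Quotient.mk_surjective _
      (φ.symm (Submodule.Quotient.mk (⟨h, hh⟩ : Q')))
    have hG : (q : M) + h ∈ G := ⟨q, ⟨h, hh⟩, by rw [hq]; simp, rfl⟩
    have hm : h ∈ (N ⊔ Q') ⊓ (N ⊔ G) :=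
      ⟨Submodule.mem_sup_right hh, Submodule.mem_sup.2
        ⟨-(q : M), N.neg_mem (hQ q.2), _, hG, by simp⟩⟩
    rw [← hd Q' G] at hm
    obtain ⟨n, hn, y, ⟨hy, ⟨a, b, hab, e⟩⟩, rfl⟩ := Submodule.mem_sup.1 hm
    have ha : (a : M) ∈ N ⊓ H := by
      refine ⟨hQ a.2, ?_⟩
      rw [eq_sub_of_add_eq e]
      exact H.sub_mem (hQ' hy) (hQ' b.2)
    have hb : (b : M) ∈ P' := by
      have : (Submodule.Quotient.mk a : Q ⧸ Submodule.comap Q.subtype P) = 0 :=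
        (Submodule.Quotient.mk_eq_zero _).2 (hP ha)
      rw [this, map_zero] at hab
      have h4 := (Submodule.Quotient.mk_eq_zero (Submodule.comap Q'.subtype P')).1 hab.symm
      exact h4
    have hy' : y ∈ P' := e ▸ P'.add_mem (hP' ha) hb
    have hn' : n ∈ P' := hP' ⟨hn, by
      have := H.sub_mem (hQ' hh) (hQ' hy)
      simpa using this⟩
    exact hh' (P'.add_mem hn' hy')
  · intro hH Y Z
    refine le_antisymm sup_inf_le ?_
    have hle : N ⊓ Y ⊔ N ⊓ Z ≤ N ⊓ (Y ⊔ Z) := le_inf_sup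
    have hle' : N ⊓ Y ⊔ Y ⊓ Z ≤ Y ⊓ (N ⊔ Z) := by
      rw [inf_comm N Y]; exact le_inf_sup
    by_cases hc : Y ⊓ (N ⊔ Z) ≤ N ⊓ Y ⊔ Y ⊓ Z
    · rintro x ⟨h1, h2⟩
      obtain ⟨n, hn, y, hy, rfl⟩ := Submodule.mem_sup.1 h1
      have : y ∈ N ⊔ Z := by
        have := (N ⊔ Z).sub_mem h2 (Submodule.mem_sup_left hn)
        simpa using this
      have h3 : y ∈ N ⊔ Y ⊓ Z := by
        have hl : N ⊓ Y ⊔ Y ⊓ Z ≤ N ⊔ Y ⊓ Z := sup_le_sup_right inf_le_left _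
        exact hl (hc ⟨hy, this⟩)
      exact Submodule.add_mem _ (Submodule.mem_sup_left hn) h3
    · exfalso
      obtain ⟨φ⟩ := aux_back N Y Z
      refine hH Y ⟨_, _, _, _, le_sup_left, lt_of_le_not_ge hle ?_, inf_le_left, le_sup_left,
        lt_of_le_not_ge hle' hc, inf_le_left, ⟨φ⟩⟩
      intro hc'
      apply hc
      intro y hy
      have h0 : φ.symm (Submodule.Quotient.mk ⟨y, hy⟩) = 0 := by
        obtain ⟨q, hq⟩ := Submodule.Quotient.mk_surjective _
          (φ.symm (Submodule.Quotient.mk ⟨y, hy⟩))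
        rw [← hq]
        exact (Submodule.Quotient.mk_eq_zero _).2 (hc' q.2)
      rw [LinearEquiv.map_eq_zero_iff] at h0
      have h4 := (Submodule.Quotient.mk_eq_zero
        (Submodule.comap (Y ⊓ (N ⊔ Z)).subtype (N ⊓ Y ⊔ Y ⊓ Z))).1 h0
      exact h4

/-- `N ⊆ M` is distributive iff for every submodule `H ⊆ M` the modules `N/(N ⊓ H)` and
`H/(N ⊓ H)` have no non-zero isomorphic subfactors. -/
theorem isDistribSubmodule_iff_no_isomorphic_subfactors {R M : Type*} [Ring R]
    [AddCommGroup M] [Module Rᵐᵒᵖ M] (N : Submodule Rᵐᵒᵖ M) :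
    IsDistribSubmodule N ↔
      ∀ H : Submodule Rᵐᵒᵖ M,
        ¬ ∃ P Q P' Q' : Submodule Rᵐᵒᵖ M,
          N ⊓ H ≤ P ∧ P < Q ∧ Q ≤ N ∧
          N ⊓ H ≤ P' ∧ P' < Q' ∧ Q' ≤ H ∧
          Nonempty ((Q ⧸ Submodule.comap Q.subtype P) ≃ₗ[Rᵐᵒᵖ]
            (Q' ⧸ Submodule.comap Q'.subtype P')) := by
  exact aux_main N
end

section
/- Let R be a ring, M a right R-module, and N a submodule of M. Then N is a distributive submodule of M if and only if for every submodule H of M, the quotient modules N/(N ⊓ H) and H/(N ⊓ H) have no isomorphic simple subfactors; explicitly: there do not exist submodules P, Q, P', Q' of M with N ⊓ H ≤ P < Q ≤ N and N ⊓ H ≤ P' < Q' ≤ H such that Q/P is a simple R-module isomorphic to Q'/P'. -/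
open Submodule in
lemma aux_simple_subfactor {S M : Type*} [Ring S] [AddCommGroup M] [Module S M]
    (A : Submodule S M) (x : M) (K : Submodule S S) (hK : IsCoatom K)
    (h : ∀ s : S, s • x ∈ A → s ∈ K) :
    ∃ P Q : Submodule S M, A ≤ P ∧ P < Q ∧ Q ≤ A ⊔ span S {x} ∧
      Nonempty ((S ⧸ K) ≃ₗ[S] (Q ⧸ Submodule.comap Q.subtype P)) := by
  let P : Submodule S M := A ⊔ K.map (LinearMap.toSpanSingleton S M x)
  let Q : Submodule S M := A ⊔ span S {x}
  have key : ∀ s : S, s • x ∈ P ↔ s ∈ K := by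
    intro s
    constructor
    · intro hs
      obtain ⟨a, ha, b, hb, hab⟩ := Submodule.mem_sup.1 hs
      obtain ⟨k, hk, rfl⟩ := hb
      have : (s - k) • x ∈ A := by
        have e : (s - k) • x = a := by
          rw [sub_smul, ← hab]; simp
        rw [e]; exact ha
      have := K.add_mem (h _ this) hk
      simpa using this
    · intro hs
      exact Submodule.mem_sup_right ⟨s, hs, rfl⟩
  have hPQ : P ≤ Q := by
    refine sup_le_sup_left ?_ _
    rintro _ ⟨k, -, rfl⟩
    exact Submodule.mem_span_singleton.2 ⟨k, rfl⟩
  have hxQ : x ∈ Q := Submodule.mem_sup_right (Submodule.mem_span_singleton_self x)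
  refine ⟨P, Q, le_sup_left, lt_of_le_of_ne hPQ ?_, le_rfl, ?_⟩
  · intro e
    have h1 : (1 : S) ∈ K := (key 1).1 (by rw [e, one_smul]; exact hxQ)
    apply hK.1
    rw [eq_top_iff]
    intro s _
    simpa using K.smul_mem s h1
  · let g : S →ₗ[S] (Q ⧸ Submodule.comap Q.subtype P) :=
      (Submodule.comap Q.subtype P).mkQ ∘ₗ LinearMap.toSpanSingleton S Q ⟨x, hxQ⟩
    have hker : LinearMap.ker g = K := by
      ext s
      rw [← key s, LinearMap.mem_ker]
      simp only [g, LinearMap.comp_apply, Submodule.mkQ_apply]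
      rw [Submodule.Quotient.mk_eq_zero]
      rfl
    have hsurj : Function.Surjective g := by
      intro q
      obtain ⟨⟨q, hq⟩, rfl⟩ := Submodule.Quotient.mk_surjective _ q
      obtain ⟨a, ha, b, hb, hab⟩ := Submodule.mem_sup.1 hq
      obtain ⟨s, rfl⟩ := Submodule.mem_span_singleton.1 hb
      refine ⟨s, ?_⟩
      simp only [g, LinearMap.comp_apply, Submodule.mkQ_apply]
      rw [Submodule.Quotient.eq]
      change s • x - q ∈ P
      have e : s • x - q = -a := by rw [← hab]; abel
      rw [e]
      exact P.neg_mem (Submodule.mem_sup_left ha)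
    exact ⟨(Submodule.quotEquivOfEq _ _ hker.symm).trans (g.quotKerEquivOfSurjective hsurj)⟩

lemma aux_forward {S M : Type*} [Ring S] [AddCommGroup M] [Module S M]
    (N H P Q P' Q' : Submodule S M) (hN : IsDistribSubmodule N)
    (h1 : N ⊓ H ≤ P) (h3 : Q ≤ N) (h4 : N ⊓ H ≤ P') (h5 : P' < Q') (h6 : Q' ≤ H)
    (f : (Q ⧸ Submodule.comap Q.subtype P) ≃ₗ[S] (Q' ⧸ Submodule.comap Q'.subtype P')) :
    False := by
  let D : Submodule S M :=
    { carrier := {m | ∃ (a : Q) (b : Q'), f (Submodule.Quotient.mk a) = Submodule.Quotient.mk b ∧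
        (a : M) + b = m}
      zero_mem' := ⟨0, 0, by simp, by simp⟩
      add_mem' := by
        rintro _ _ ⟨a, b, hab, rfl⟩ ⟨c, d, hcd, rfl⟩
        refine ⟨a + c, b + d, ?_, ?_⟩
        · rw [Submodule.Quotient.mk_add, map_add, hab, hcd, Submodule.Quotient.mk_add]
        · push_cast; abel
      smul_mem' := by
        rintro s _ ⟨a, b, hab, rfl⟩
        refine ⟨s • a, s • b, ?_, ?_⟩
        · rw [Submodule.Quotient.mk_smul, map_smul, hab, Submodule.Quotient.mk_smul]
        · push_cast; rw [smul_add] }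
  obtain ⟨-, q', hq', hnq⟩ := SetLike.lt_iff_le_and_exists.1 h5
  apply hnq
  obtain ⟨q, hq⟩ := Submodule.Quotient.mk_surjective _ (f.symm (Submodule.Quotient.mk ⟨q', hq'⟩))
  have hD : (q : M) + q' ∈ D := ⟨q, ⟨q', hq'⟩, by rw [hq]; simp, rfl⟩
  have hmem : q' ∈ (N ⊔ D) ⊓ (N ⊔ H) := by
    refine ⟨?_, Submodule.mem_sup_right (h6 hq')⟩
    exact Submodule.mem_sup.2 ⟨-q, N.neg_mem (h3 q.2), _, hD, by abel⟩
  rw [← hN D H] at hmem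
  obtain ⟨n, hn, d, ⟨⟨a, b, hab, rfl⟩, hdH⟩, hsum⟩ := Submodule.mem_sup.1 hmem
  have haH : (a : M) ∈ H := by
    have := H.sub_mem hdH (h6 b.2)
    simpa using this
  have haP : (a : M) ∈ P := h1 ⟨h3 a.2, haH⟩
  have ha0 : (Submodule.Quotient.mk a : Q ⧸ Submodule.comap Q.subtype P) = 0 :=
    (Submodule.Quotient.mk_eq_zero _).2 haP
  rw [ha0, map_zero] at hab
  have hbP : (b : M) ∈ P' :=
    (Submodule.Quotient.mk_eq_zero (Submodule.comap Q'.subtype P')).1 hab.symm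
  have e : n + a = q' - b := by rw [← hsum]; abel
  have hmem2 : n + a ∈ P' := by
    refine h4 ⟨N.add_mem hn (h3 a.2), ?_⟩
    rw [e]
    exact H.sub_mem (h6 hq') (h6 b.2)
  have := P'.add_mem hmem2 hbP
  rw [e] at this
  simpa using this

open Submodule in
lemma aux_backward {S M : Type*} [Ring S] [AddCommGroup M] [Module S M]
    (N : Submodule S M) (hN : ¬ IsDistribSubmodule N) :
    ∃ H P Q P' Q' : Submodule S M,
          N ⊓ H ≤ P ∧ P < Q ∧ Q ≤ N ∧
          N ⊓ H ≤ P' ∧ P' < Q' ∧ Q' ≤ H ∧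
          IsSimpleModule S (Q ⧸ Submodule.comap Q.subtype P) ∧
          Nonempty ((Q ⧸ Submodule.comap Q.subtype P) ≃ₗ[S]
            (Q' ⧸ Submodule.comap Q'.subtype P')) := by
  unfold IsDistribSubmodule at hN
  push Not at hN
  obtain ⟨Y, Z, hYZ⟩ := hN
  have hle : N ⊔ Y ⊓ Z ≤ (N ⊔ Y) ⊓ (N ⊔ Z) := sup_inf_le
  obtain ⟨-, x, ⟨hx1, hx2⟩, hx⟩ := SetLike.lt_iff_le_and_exists.1 (lt_of_le_of_ne hle hYZ)
  obtain ⟨n₁, hn₁, y, hy, hxy⟩ := Submodule.mem_sup.1 hx1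
  obtain ⟨n₂, hn₂, z, hz, hxz⟩ := Submodule.mem_sup.1 hx2
  have hynot : y ∉ N ⊔ Y ⊓ Z := fun hy' => hx (by
    rw [← hxy]; exact add_mem (Submodule.mem_sup_left hn₁) hy')
  let I : Submodule S S := (N ⊔ Y ⊓ Z).comap (LinearMap.toSpanSingleton S M y)
  have hI : I ≠ ⊤ := by
    intro e
    have : (1 : S) ∈ I := by rw [e]; trivial
    exact hynot (by simpa [I] using this)
  obtain ⟨K, hK, hIK⟩ := (eq_top_or_exists_le_coatom I).resolve_left hI
  have hIK' : ∀ s : S, s • y ∈ N ⊔ Y ⊓ Z → s ∈ K := fun s hs => hIK hs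
  have hyn : y - (n₂ - n₁) = z := by
    have : y = x - n₁ := by rw [← hxy]; abel
    rw [this, ← hxz]; abel
  obtain ⟨P, Q, h1, h2, h3, ⟨e⟩⟩ := aux_simple_subfactor (N ⊓ Y) (n₂ - n₁) K hK (by
    intro s hs
    apply hIK'
    have hz' : s • z ∈ Y ⊓ Z := by
      refine ⟨?_, Z.smul_mem _ hz⟩
      rw [← hyn, smul_sub]
      exact Y.sub_mem (Y.smul_mem _ hy) hs.2
    have : s • y = s • (n₂ - n₁) + s • z := by rw [← hyn, ← smul_add]; congr 1; abel
    rw [this]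
    exact Submodule.add_mem_sup hs.1 hz')
  obtain ⟨P', Q', h1', h2', h3', ⟨e'⟩⟩ := aux_simple_subfactor (N ⊓ Y) y K hK (by
    intro s hs
    exact hIK' s (Submodule.mem_sup_left hs.1))
  have hsimp : IsSimpleModule S (S ⧸ K) := isSimpleModule_iff_isCoatom.2 hK
  refine ⟨Y, P, Q, P', Q', h1, h2, h3.trans (sup_le inf_le_left ?_), h1', h2',
    h3'.trans (sup_le inf_le_right ?_), IsSimpleModule.congr e.symm, ⟨e.symm.trans e'⟩⟩
  · rw [Submodule.span_singleton_le_iff_mem]; exact N.sub_mem hn₂ hn₁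
  · rw [Submodule.span_singleton_le_iff_mem]; exact hy

/-- `N ⊆ M` is distributive iff for every submodule `H ⊆ M` the modules `N/(N ⊓ H)` and
`H/(N ⊓ H)` have no isomorphic simple subfactors. -/
theorem isDistribSubmodule_iff_no_simple_subfactors {R M : Type*} [Ring R]
    [AddCommGroup M] [Module Rᵐᵒᵖ M] (N : Submodule Rᵐᵒᵖ M) :
    IsDistribSubmodule N ↔
      ∀ H : Submodule Rᵐᵒᵖ M,
        ¬ ∃ P Q P' Q' : Submodule Rᵐᵒᵖ M,
          N ⊓ H ≤ P ∧ P < Q ∧ Q ≤ N ∧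
          N ⊓ H ≤ P' ∧ P' < Q' ∧ Q' ≤ H ∧
          IsSimpleModule Rᵐᵒᵖ (Q ⧸ Submodule.comap Q.subtype P) ∧
          Nonempty ((Q ⧸ Submodule.comap Q.subtype P) ≃ₗ[Rᵐᵒᵖ]
            (Q' ⧸ Submodule.comap Q'.subtype P')) := by
  constructor
  · rintro hN H ⟨P, Q, P', Q', h1, h2, h3, h4, h5, h6, -, ⟨f⟩⟩
    exact aux_forward N H P Q P' Q' hN h1 h3 h4 h5 h6 f
  · intro h
    by_contra hN
    obtain ⟨H, hH⟩ := aux_backward N hN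
    exact h H hH
end

section
/- Let R be a ring, M a right R-module, and N a submodule of M. Then N is a distributive submodule of M if and only if for every m ∈ M and every n ∈ N, setting C := N ⊓ m·R, the cyclic modules (n·R ⊔ C)/C and (m·R)/C have no isomorphic simple subfactors; explicitly: there do not exist submodules P, Q, P', Q' of M with C ≤ P < Q ≤ n·R ⊔ C and C ≤ P' < Q' ≤ m·R such that Q/P is a simple R-module isomorphic to Q'/P'. -/
theorem distrib_aux_equiv {S M : Type*} [Ring S] [AddCommGroup M] [Module S M]
    (x : M) (I : Submodule S S) (C Q : Submodule S M) (hQ : Q = Submodule.span S {x} ⊔ C)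
    (hI : ∀ r : S, r • x ∈ C → r ∈ I) (h1 : (1 : S) ∉ I) :
    C ≤ Submodule.map (LinearMap.toSpanSingleton S M x) I ⊔ C ∧
    Submodule.map (LinearMap.toSpanSingleton S M x) I ⊔ C < Q ∧
    Nonempty ((S ⧸ I) ≃ₗ[S]
      (Q ⧸ Submodule.comap Q.subtype (Submodule.map (LinearMap.toSpanSingleton S M x) I ⊔ C))) := by
  set P := Submodule.map (LinearMap.toSpanSingleton S M x) I ⊔ C with hP
  have hmem : ∀ r : S, r • x ∈ P ↔ r ∈ I := by
    intro r
    constructor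
    · intro h
      obtain ⟨a, ha, c, hc, hac⟩ := Submodule.mem_sup.1 h
      obtain ⟨i, hi, rfl⟩ := Submodule.mem_map.1 ha
      have h2 : (r - i) • x ∈ C := by
        rw [sub_smul, ← hac]
        simpa using hc
      have := I.add_mem (hI _ h2) hi
      simpa using this
    · intro h
      exact Submodule.mem_sup_left (Submodule.mem_map.2 ⟨r, h, by simp⟩)
  have hxQ : x ∈ Q := by
    rw [hQ]
    exact Submodule.mem_sup_left (Submodule.mem_span_singleton_self x)
  have hCP : C ≤ P := le_sup_right
  have hPQ : P ≤ Q := by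
    refine sup_le ?_ (hQ ▸ le_sup_right)
    rintro _ ⟨i, _, rfl⟩
    simpa using Q.smul_mem i hxQ
  refine ⟨hCP, lt_of_le_of_ne hPQ ?_, ?_⟩
  · intro h
    apply h1
    rw [← hmem, one_smul, h]
    exact hxQ
  · let φ : S →ₗ[S] (Q ⧸ Submodule.comap Q.subtype P) :=
      (Submodule.comap Q.subtype P).mkQ ∘ₗ LinearMap.toSpanSingleton S Q ⟨x, hxQ⟩
    have hker : LinearMap.ker φ = I := by
      ext r
      rw [← hmem]
      simp [φ]
    have hsurj : Function.Surjective φ := by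
      intro y
      obtain ⟨⟨q, hq⟩, rfl⟩ := Submodule.mkQ_surjective _ y
      have hq' := hq
      rw [hQ] at hq'
      obtain ⟨a, ha, c, hc, hac⟩ := Submodule.mem_sup.1 hq'
      obtain ⟨r, rfl⟩ := Submodule.mem_span_singleton.1 ha
      refine ⟨r, ?_⟩
      simp only [φ, LinearMap.comp_apply, Submodule.mkQ_apply]
      rw [Submodule.Quotient.eq]
      have : r • x - q = -c := by rw [← hac]; abel
      simpa [this] using hCP hc
    exact ⟨(Submodule.quotEquivOfEq _ _ hker.symm).trans (φ.quotKerEquivOfSurjective hsurj)⟩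

theorem distrib_aux_forward {S M : Type*} [Ring S] [AddCommGroup M] [Module S M]
    (N P Q P' Q' : Submodule S M) (hN : IsDistribSubmodule N) (hQN : Q ≤ N)
    (hP : N ⊓ Q' ≤ P) (hP' : N ⊓ Q' ≤ P') (hlt : P' < Q')
    (f : (Q ⧸ Submodule.comap Q.subtype P) ≃ₗ[S] (Q' ⧸ Submodule.comap Q'.subtype P')) :
    False := by
  let g : (Q × Q') →ₗ[S] (Q' ⧸ Submodule.comap Q'.subtype P') :=
    (f.toLinearMap ∘ₗ (Submodule.comap Q.subtype P).mkQ ∘ₗ LinearMap.fst S Q Q') -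
      ((Submodule.comap Q'.subtype P').mkQ ∘ₗ LinearMap.snd S Q Q')
  let Y : Submodule S M := Submodule.map (Q.subtype.coprod Q'.subtype) (LinearMap.ker g)
  apply not_le_of_gt hlt
  have key : Q' ⊓ Y ≤ P' := by
    rintro z ⟨hz, ⟨⟨⟨x, hx⟩, ⟨y, hy⟩⟩, hg, rfl⟩⟩
    simp only [LinearMap.coprod_apply, Submodule.subtype_apply] at hz ⊢
    have hx' : x ∈ Q' := by simpa using Q'.sub_mem hz hy
    have hxN : x ∈ N ⊓ Q' := ⟨hQN hx, hx'⟩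
    have h0 : (Submodule.Quotient.mk ⟨x, hx⟩ : Q ⧸ Submodule.comap Q.subtype P) = 0 := by
      rw [Submodule.Quotient.mk_eq_zero]
      exact hP hxN
    have hg' : g (⟨x, hx⟩, ⟨y, hy⟩) = 0 := hg
    simp only [g, LinearMap.sub_apply, LinearMap.comp_apply, LinearMap.fst_apply,
      LinearMap.snd_apply, Submodule.mkQ_apply, h0, map_zero, zero_sub, neg_eq_zero] at hg'
    rw [Submodule.Quotient.mk_eq_zero] at hg'
    exact P'.add_mem (hP' hxN) hg'
  intro y hy
  have hmem : y ∈ (N ⊔ Q') ⊓ (N ⊔ Y) := by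
    refine ⟨Submodule.mem_sup_right hy, ?_⟩
    obtain ⟨⟨x, hx⟩, hxe⟩ := Submodule.mkQ_surjective _ (f.symm (Submodule.Quotient.mk ⟨y, hy⟩))
    refine Submodule.mem_sup.2 ⟨-x, N.neg_mem (hQN hx), x + y, ?_, by abel⟩
    refine Submodule.mem_map.2 ⟨(⟨x, hx⟩, ⟨y, hy⟩), ?_, by simp⟩
    rw [LinearMap.mem_ker]
    simp only [g, LinearMap.sub_apply, LinearMap.comp_apply, LinearMap.fst_apply,
      LinearMap.snd_apply, hxe]
    simp
  rw [← hN] at hmem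
  obtain ⟨n, hn, p, hp, rfl⟩ := Submodule.mem_sup.1 hmem
  have hp' := key hp
  have : n ∈ Q' := by simpa using Q'.sub_mem hy hp.1
  exact P'.add_mem (hP' ⟨hn, this⟩) hp'

/-- `N ⊆ M` is distributive iff for every `m ∈ M` and `n ∈ N`, with `C = N ⊓ mR`, the cyclic
modules `(nR ⊔ C)/C` and `mR/C` have no isomorphic simple subfactors. -/
theorem isDistribSubmodule_iff_no_simple_subfactors_cyclic {R M : Type*} [Ring R]
    [AddCommGroup M] [Module Rᵐᵒᵖ M] (N : Submodule Rᵐᵒᵖ M) :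
    IsDistribSubmodule N ↔
      ∀ m : M, ∀ n ∈ N,
        ¬ ∃ P Q P' Q' : Submodule Rᵐᵒᵖ M,
          N ⊓ Submodule.span Rᵐᵒᵖ ({m} : Set M) ≤ P ∧ P < Q ∧
            Q ≤ Submodule.span Rᵐᵒᵖ ({n} : Set M) ⊔
              (N ⊓ Submodule.span Rᵐᵒᵖ ({m} : Set M)) ∧
          N ⊓ Submodule.span Rᵐᵒᵖ ({m} : Set M) ≤ P' ∧ P' < Q' ∧
            Q' ≤ Submodule.span Rᵐᵒᵖ ({m} : Set M) ∧
          IsSimpleModule Rᵐᵒᵖ (Q ⧸ Submodule.comap Q.subtype P) ∧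
          Nonempty ((Q ⧸ Submodule.comap Q.subtype P) ≃ₗ[Rᵐᵒᵖ]
            (Q' ⧸ Submodule.comap Q'.subtype P')) := by
  constructor
  · rintro hN m n hn ⟨P, Q, P', Q', hCP, _, hQ, hCP', hlt', hQ', _, ⟨f⟩⟩
    have hle : N ⊓ Q' ≤ N ⊓ Submodule.span Rᵐᵒᵖ ({m} : Set M) := inf_le_inf_left _ hQ'
    refine distrib_aux_forward N P Q P' Q' hN (hQ.trans (sup_le ?_ inf_le_left))
      (hle.trans hCP) (hle.trans hCP') hlt' f
    simpa using hn
  · intro h Y₁ Y₂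
    refine le_antisymm (le_inf (sup_le_sup_left inf_le_left _) (sup_le_sup_left inf_le_right _)) ?_
    rintro z ⟨hz1, hz2⟩
    by_contra hz
    obtain ⟨n1, hn1, m, hm, rfl⟩ := Submodule.mem_sup.1 hz1
    obtain ⟨n2, hn2, y2, hy2, he⟩ := Submodule.mem_sup.1 hz2
    have hnN : n2 - n1 ∈ N := N.sub_mem hn2 hn1
    have hy : y2 = m - (n2 - n1) := by
      have : y2 = (n1 + m) - n2 := by rw [← he]; abel
      rw [this]; abel
    set n := n2 - n1 with hn
    have hmD : m ∉ N ⊔ (Y₁ ⊓ Y₂) := fun hh =>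
      hz (Submodule.add_mem _ (Submodule.mem_sup_left hn1) hh)
    let J : Submodule Rᵐᵒᵖ Rᵐᵒᵖ :=
      Submodule.comap (LinearMap.toSpanSingleton Rᵐᵒᵖ M m) (N ⊔ (Y₁ ⊓ Y₂))
    have hJ : ∀ r, r ∈ J ↔ r • m ∈ N ⊔ (Y₁ ⊓ Y₂) := fun r => by simp [J]
    have hJ1 : J ≠ ⊤ := by
      intro hh
      have h1 : (1 : Rᵐᵒᵖ) ∈ J := hh ▸ Submodule.mem_top
      rw [hJ, one_smul] at h1
      exact hmD h1
    obtain ⟨I, hImax, hJI⟩ := Ideal.exists_le_maximal J hJ1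
    have hI1 : (1 : Rᵐᵒᵖ) ∉ I := (Ideal.ne_top_iff_one I).1 hImax.ne_top
    have hsimp : IsSimpleModule Rᵐᵒᵖ (Rᵐᵒᵖ ⧸ I) := isSimpleModule_iff_isCoatom.2 hImax.out
    set C := N ⊓ Submodule.span Rᵐᵒᵖ ({m} : Set M) with hC
    have hspan : Submodule.span Rᵐᵒᵖ ({m} : Set M) ≤ Y₁ := by simpa using hm
    obtain ⟨a1, a2, ⟨e1⟩⟩ := distrib_aux_equiv n I C _ rfl (by
      intro r hr
      apply hJI
      rw [hJ]
      have h1 : r • (m - n) ∈ Y₁ ⊓ Y₂ := by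
        refine ⟨?_, hy ▸ Y₂.smul_mem r hy2⟩
        rw [smul_sub r m n]
        exact Y₁.sub_mem (Y₁.smul_mem r hm) (hspan hr.2)
      have h2 : r • m = r • n + r • (m - n) := by rw [← smul_add, add_sub_cancel]
      rw [h2]
      exact Submodule.add_mem _ (Submodule.mem_sup_left hr.1) (Submodule.mem_sup_right h1)) hI1
    obtain ⟨b1, b2, ⟨e2⟩⟩ := distrib_aux_equiv m I C (Submodule.span Rᵐᵒᵖ ({m} : Set M))
      (sup_eq_left.2 inf_le_right).symm (by
        intro r hr
        apply hJI
        rw [hJ]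
        exact Submodule.mem_sup_left hr.1) hI1
    exact h m n hnN ⟨_, _, _, _, a1, a2, le_rfl, b1, b2, le_rfl,
      IsSimpleModule.congr e1.symm, ⟨e1.symm.trans e2⟩⟩
end
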